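/- Let A ∈ ℂ^{m×n}, U ∈ ℂ^{m×r}, V ∈ ℂ^{n×r}, and S_A = I + V*A†U. If R(U) ⊆ R(A), then (A + UV*)(I + A†U F_{S_A} U*(A†)*) = A + UV*, and consequently (A + UV*)(I + A†U F_{S_A} U*(A†)*)^{-1} = A + UV*. -/

import Mathlib

open Matrix

/-- `Z` is the Moore–Penrose inverse of `A`. -/
def IsMP {m n : Type*} [Fintype m] [Fintype n]
    (A : Matrix m n ℂ) (Z : Matrix n m ℂ) : Prop :=
  A * Z * A = A ∧ Z * A * Z = Z ∧ (A * Z)ᴴ = A * Z ∧ (Z * A)ᴴ = Z * A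

/-- A Moore–Penrose inverse `Z` of `A` makes `A * Z` act as the identity on the range of `A`. -/
theorem IsMP.mul_mul_eq_of_range_le {m n r : Type*} [Fintype m] [Fintype n] [Fintype r]
    {A : Matrix m n ℂ} {Z : Matrix n m ℂ} (h : IsMP A Z) {U : Matrix m r ℂ}
    (hU : LinearMap.range U.mulVecLin ≤ LinearMap.range A.mulVecLin) :
    A * Z * U = U := by
  classical
  refine Matrix.ext_of_mulVec_single fun j => ?_
  obtain ⟨w, hw⟩ := hU (LinearMap.mem_range_self U.mulVecLin (Pi.single j 1))
  simp only [Matrix.mulVecLin_apply] at hw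
  rw [← Matrix.mulVec_mulVec, ← hw, Matrix.mulVec_mulVec, h.1]

/-- The matrix `1 - Z * A` is an orthogonal projection, so it equals its own Gram matrix. -/
theorem IsMP.one_sub_mul_conjTranspose_self {m n : Type*} [Fintype m] [Fintype n] [DecidableEq n]
    {A : Matrix m n ℂ} {Z : Matrix n m ℂ} (h : IsMP A Z) :
    (1 - Z * A) * (1 - Z * A)ᴴ = 1 - Z * A := by
  have hidem : Z * A * (Z * A) = Z * A := by rw [← Matrix.mul_assoc, h.2.1]
  rw [Matrix.conjTranspose_sub, Matrix.conjTranspose_one, h.2.2.2, Matrix.mul_sub, Matrix.mul_one,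
    Matrix.sub_mul, hidem, Matrix.one_mul, sub_self, sub_zero]

open scoped ComplexOrder in
theorem Matrix.isUnit_one_add_mul_conjTranspose_self {m n : Type*} [Fintype m] [Fintype n]
    [DecidableEq m] (B : Matrix m n ℂ) : IsUnit (1 + B * Bᴴ) :=
  (Matrix.PosDef.one.add_posSemidef (Matrix.posSemidef_self_mul_conjTranspose B)).isUnit

theorem stmt_11 {m n r : ℕ}
    (A : Matrix (Fin m) (Fin n) ℂ) (U : Matrix (Fin m) (Fin r) ℂ)
    (V : Matrix (Fin n) (Fin r) ℂ)
    (Adag : Matrix (Fin n) (Fin m) ℂ) (hAdag : IsMP A Adag)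
    (S : Matrix (Fin r) (Fin r) ℂ) (hS : S = 1 + Vᴴ * Adag * U)
    (Sdag : Matrix (Fin r) (Fin r) ℂ) (hSdag : IsMP S Sdag)
    (hU : LinearMap.range U.mulVecLin ≤ LinearMap.range A.mulVecLin) :
    (A + U * Vᴴ) * (1 + Adag * U * (1 - Sdag * S) * Uᴴ * Adagᴴ) = A + U * Vᴴ ∧
      (A + U * Vᴴ) * (1 + Adag * U * (1 - Sdag * S) * Uᴴ * Adagᴴ)⁻¹ = A + U * Vᴴ := by
  have hAU : A * Adag * U = U := hAdag.mul_mul_eq_of_range_le hU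
  have hSF : S * (1 - Sdag * S) = 0 := by
    rw [Matrix.mul_sub, ← Matrix.mul_assoc, hSdag.1, Matrix.mul_one, sub_self]
  have hUS : (A + U * Vᴴ) * (Adag * U) = U * S := by
    rw [hS, Matrix.add_mul, ← Matrix.mul_assoc, hAU]
    simp only [Matrix.mul_add, Matrix.mul_one, Matrix.mul_assoc]
  have hmul : (A + U * Vᴴ) * (1 + Adag * U * (1 - Sdag * S) * Uᴴ * Adagᴴ) = A + U * Vᴴ := by
    have hzero : (A + U * Vᴴ) * (Adag * U * (1 - Sdag * S) * Uᴴ * Adagᴴ) = 0 := by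
      simp only [← Matrix.mul_assoc (A + U * Vᴴ)]
      rw [Matrix.mul_assoc (A + U * Vᴴ), hUS, Matrix.mul_assoc U, hSF]
      simp
    rw [Matrix.mul_add, hzero, Matrix.mul_one, add_zero]
  have hgram : Adag * U * (1 - Sdag * S) * Uᴴ * Adagᴴ =
      (Adag * U * (1 - Sdag * S)) * (Adag * U * (1 - Sdag * S))ᴴ := by
    conv_lhs => rw [← hSdag.one_sub_mul_conjTranspose_self]
    simp only [Matrix.conjTranspose_mul, Matrix.mul_assoc]
  have hunit : IsUnit (1 + Adag * U * (1 - Sdag * S) * Uᴴ * Adagᴴ) := by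
    rw [hgram]
    exact Matrix.isUnit_one_add_mul_conjTranspose_self _
  refine ⟨hmul, ?_⟩
  have hdet := (Matrix.isUnit_iff_isUnit_det _).mp hunit
  conv_lhs => rw [← hmul]
  exact Matrix.mul_nonsing_inv_cancel_right _ _ hdet
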